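/- Let d = 3. There exists a Borel measurable function V : ℝ³ → ℝ with V ≤ 0 such that: (a) V belongs to the Kato class 𝒦_3, i.e. lim_{t→0⁺} sup_{x∈ℝ³} ∫_0^t ∫_{ℝ³} g(s,x,z)|V(z)| dz ds = 0; and (b) ‖S(V,t)‖_∞ = ∞ for every t > 0. -/

import Mathlib

open MeasureTheory Filter
open scoped ENNReal

/-- The Gauss-Weierstrass kernel on `ℝ^d`. -/
noncomputable def gauss (d : ℕ) (t : ℝ) (x y : EuclideanSpace ℝ (Fin d)) : ℝ :=
  (4 * Real.pi * t) ^ (-(d : ℝ) / 2) * Real.exp (-‖y - x‖ ^ 2 / (4 * t))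

/-- `S(V,t,x,y)`. -/
noncomputable def Sk (d : ℕ) (V : EuclideanSpace ℝ (Fin d) → ℝ) (t : ℝ)
    (x y : EuclideanSpace ℝ (Fin d)) : ℝ≥0∞ :=
  ∫⁻ s in Set.Ioo (0 : ℝ) t, ∫⁻ z,
    ENNReal.ofReal (gauss d s x z * gauss d (t - s) z y / gauss d t x y * |V z|)

/-- `‖S(V,t)‖_∞`. -/
noncomputable def SNorm (d : ℕ) (V : EuclideanSpace ℝ (Fin d) → ℝ) (t : ℝ) : ℝ≥0∞ :=
  ⨆ x, ⨆ y, Sk d V t x y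

/-- `‖S(V)‖_{T,∞}`. -/
noncomputable def SNormT (d : ℕ) (V : EuclideanSpace ℝ (Fin d) → ℝ) (T : ℝ) : ℝ≥0∞ :=
  ⨆ t ∈ Set.Ioc (0 : ℝ) T, SNorm d V t

/-- `sup_x ∫_0^t ∫ g(s,x,z)|V(z)| dz ds`. -/
noncomputable def katoA (d : ℕ) (V : EuclideanSpace ℝ (Fin d) → ℝ) (t : ℝ) : ℝ≥0∞ :=
  ⨆ x, ∫⁻ s in Set.Ioo (0 : ℝ) t, ∫⁻ z, ENNReal.ofReal (gauss d s x z * |V z|)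

open ProbabilityTheory in
theorem gauss_eq_prod {s : ℝ} (hs : 0 < s) (x z : EuclideanSpace ℝ (Fin 3)) :
    gauss 3 s x z = ∏ i, gaussianPDFReal (x i) (2 * s).toNNReal (z i) := by
  have h4 : 0 < 4 * Real.pi * s := by positivity
  simp only [gauss, gaussianPDFReal, Finset.prod_mul_distrib, ← Real.exp_sum, Finset.prod_const,
    Real.coe_toNNReal _ (by positivity : (0 : ℝ) ≤ 2 * s), Finset.card_univ, Fintype.card_fin]
  congr 1
  · rw [show 2 * Real.pi * (2 * s) = 4 * Real.pi * s by ring, Real.sqrt_eq_rpow,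
      ← Real.rpow_neg h4.le, ← Real.rpow_natCast, ← Real.rpow_mul h4.le]
    norm_num
  · rw [EuclideanSpace.real_norm_sq_eq]
    simp only [Fin.sum_univ_three, PiLp.sub_apply]
    congr 1
    ring

theorem lintegral_euclidean_prod {f : Fin 3 → ℝ → ℝ} (hf : ∀ i, Integrable (f i))
    (h0 : ∀ i z, 0 ≤ f i z) :
    ∫⁻ z : EuclideanSpace ℝ (Fin 3), ENNReal.ofReal (∏ i, f i (z i)) =
      ENNReal.ofReal (∏ i, ∫ z, f i z) := by
  have hp : Integrable (fun z : Fin 3 → ℝ => ∏ i, f i (z i)) := Integrable.fintype_prod hf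
  rw [← integral_fintype_prod_volume_eq_prod, ofReal_integral_eq_lintegral_ofReal hp
    (ae_of_all _ fun z => Finset.prod_nonneg fun i _ => h0 i _),
    ← (PiLp.volume_preserving_ofLp (Fin 3)).lintegral_comp_emb
      (MeasurableEquiv.toLp 2 (Fin 3 → ℝ)).symm.measurableEmbedding]

theorem gauss_nonneg {d : ℕ} {s : ℝ} (hs : 0 ≤ s) (x z : EuclideanSpace ℝ (Fin d)) :
    0 ≤ gauss d s x z := by
  unfold gauss
  positivity

open ProbabilityTheory in
theorem lintegral_gauss {s : ℝ} (hs : 0 < s) (x : EuclideanSpace ℝ (Fin 3)) :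
    ∫⁻ z, ENNReal.ofReal (gauss 3 s x z) = 1 := by
  have hv : (2 * s).toNNReal ≠ 0 := by simpa using hs
  simp_rw [gauss_eq_prod hs]
  rw [lintegral_euclidean_prod (fun i => integrable_gaussianPDFReal _ _)
    (fun i => gaussianPDFReal_nonneg _ _)]
  simp [integral_gaussianPDFReal_eq_one _ hv]

/-- An infinite square tube of half-width `r` around the first coordinate axis. -/
def tube (r : ℝ) : Set (EuclideanSpace ℝ (Fin 3)) := {z | |z 1| ≤ r ∧ |z 2| ≤ r}

theorem measurableSet_tube (r : ℝ) : MeasurableSet (tube r) :=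
  (measurableSet_le (f := fun z : EuclideanSpace ℝ (Fin 3) => |z 1|) (by fun_prop)
    measurable_const).inter (measurableSet_le (f := fun z : EuclideanSpace ℝ (Fin 3) => |z 2|)
    (by fun_prop) measurable_const)

open ProbabilityTheory in
theorem setLIntegral_gauss_tube_le {s r : ℝ} (hs : 0 < s) (hr : 0 ≤ r)
    (x : EuclideanSpace ℝ (Fin 3)) :
    ∫⁻ z in tube r, ENNReal.ofReal (gauss 3 s x z) ≤ ENNReal.ofReal (r ^ 2 / s) := by
  have hv : (2 * s).toNNReal ≠ 0 := by simpa using hs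
  have hm := measurableSet_tube r
  let A : Fin 3 → Set ℝ := ![Set.univ, Set.Icc (-r) r, Set.Icc (-r) r]
  have hA : ∀ i, MeasurableSet (A i) := by
    intro i; fin_cases i <;> simp [A, measurableSet_Icc]
  have key : ∀ z, (tube r).indicator (fun z => ENNReal.ofReal (gauss 3 s x z)) z =
      ENNReal.ofReal (∏ i, (A i).indicator (gaussianPDFReal (x i) (2 * s).toNNReal) (z i)) := by
    intro z
    by_cases hz : z ∈ tube r
    · have h1 : z 1 ∈ Set.Icc (-r) r := abs_le.mp hz.1
      have h2 : z 2 ∈ Set.Icc (-r) r := abs_le.mp hz.2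
      rw [Set.indicator_of_mem hz, gauss_eq_prod hs]
      simp [Fin.prod_univ_three, A, Set.indicator_of_mem h1, Set.indicator_of_mem h2]
    · rw [Set.indicator_of_notMem hz]
      have : z 1 ∉ Set.Icc (-r) r ∨ z 2 ∉ Set.Icc (-r) r := by
        by_contra! h
        exact hz ⟨abs_le.mpr h.1, abs_le.mpr h.2⟩
      rcases this with h | h <;> simp [Fin.prod_univ_three, A, Set.indicator_of_notMem h]
  rw [← lintegral_indicator hm]
  simp_rw [key]
  rw [lintegral_euclidean_prod
    (fun i => (integrable_gaussianPDFReal _ _).indicator (hA i))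
    (fun i => Set.indicator_nonneg fun _ _ => gaussianPDFReal_nonneg _ _ _)]
  apply ENNReal.ofReal_le_ofReal
  have hb : ∀ m : ℝ, ∫ z, (Set.Icc (-r) r).indicator (gaussianPDFReal m (2 * s).toNNReal) z ≤
      r / √s := by
    intro m
    rw [integral_indicator measurableSet_Icc]
    have hle : ∀ z ∈ Set.Icc (-r) r, gaussianPDFReal m (2 * s).toNNReal z ≤ (2 * √s)⁻¹ := by
      intro z _
      rw [gaussianPDFReal, Real.coe_toNNReal _ (by positivity : (0 : ℝ) ≤ 2 * s)]
      have e1 : Real.exp (-(z - m) ^ 2 / (2 * (2 * s))) ≤ 1 := by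
        rw [Real.exp_le_one_iff, neg_div]
        have : 0 ≤ (z - m) ^ 2 / (2 * (2 * s)) := by positivity
        linarith
      have e2 : (√(2 * Real.pi * (2 * s)))⁻¹ ≤ (2 * √s)⁻¹ := by
        apply inv_anti₀ (by positivity)
        rw [show (2 : ℝ) = √4 by rw [show (4 : ℝ) = 2 ^ 2 by norm_num]; simp,
          ← Real.sqrt_mul (by norm_num)]
        apply Real.sqrt_le_sqrt
        have : (√4 : ℝ) = 2 := by rw [show (4 : ℝ) = 2 ^ 2 by norm_num]; simp
        rw [this]
        nlinarith [Real.pi_gt_three]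
      calc _ ≤ (√(2 * Real.pi * (2 * s)))⁻¹ * 1 := by gcongr
        _ ≤ _ := by simpa using e2
    calc _ ≤ ∫ z in Set.Icc (-r) r, (2 * √s)⁻¹ :=
          setIntegral_mono_on (integrable_gaussianPDFReal _ _).integrableOn
            (integrableOn_const (by simp)) measurableSet_Icc hle
      _ = _ := by
          simp [hr]
          field_simp
          ring
  have h1 := hb (x 1)
  have h2 := hb (x 2)
  have n1 : 0 ≤ ∫ z, (Set.Icc (-r) r).indicator (gaussianPDFReal (x 1) (2 * s).toNNReal) z :=
    integral_nonneg (Set.indicator_nonneg fun _ _ => gaussianPDFReal_nonneg _ _ _)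
  have n2 : 0 ≤ ∫ z, (Set.Icc (-r) r).indicator (gaussianPDFReal (x 2) (2 * s).toNNReal) z :=
    integral_nonneg (Set.indicator_nonneg fun _ _ => gaussianPDFReal_nonneg _ _ _)
  simp only [Fin.prod_univ_three, A, Matrix.cons_val_zero, Matrix.cons_val_one, Matrix.cons_val,
    Set.indicator_univ, integral_gaussianPDFReal_eq_one _ hv, one_mul]
  calc _ ≤ (r / √s) * (r / √s) := by gcongr
    _ = _ := by rw [div_mul_div_comm, Real.mul_self_sqrt hs.le, sq]

/-- Mass of the heat kernel at horizontal distance at least `D`. -/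
theorem setLIntegral_gauss_far_le {s D : ℝ} (hs : 0 < s) (hs1 : s ≤ 1) (hD : 0 < D)
    (x : EuclideanSpace ℝ (Fin 3)) {B : Set (EuclideanSpace ℝ (Fin 3))} (hB : MeasurableSet B)
    (h : ∀ z ∈ B, D ≤ |z 0 - x 0|) :
    ∫⁻ z in B, ENNReal.ofReal (gauss 3 s x z) ≤ ENNReal.ofReal (24 / D ^ 2) := by
  have hle : ∀ z ∈ B, ENNReal.ofReal (gauss 3 s x z) ≤
      ENNReal.ofReal (24 / D ^ 2) * ENNReal.ofReal (gauss 3 (2 * s) x z) := by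
    intro z hz
    rw [← ENNReal.ofReal_mul (by positivity)]
    apply ENNReal.ofReal_le_ofReal
    have hn : D ^ 2 ≤ ‖z - x‖ ^ 2 := by
      have := PiLp.norm_apply_le (z - x) 0
      rw [Real.norm_eq_abs, PiLp.sub_apply] at this
      gcongr
      exact (h z hz).trans this
    set N := ‖z - x‖ ^ 2
    have h4 : 0 < 4 * Real.pi * s := by positivity
    have hN : 0 < N := lt_of_lt_of_le (by positivity) hn
    have hexp : Real.exp (-N / (8 * s)) ≤ 8 / D ^ 2 := by
      have hu : 0 < N / (8 * s) := by positivity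
      have := Real.add_one_le_exp (N / (8 * s))
      rw [neg_div, Real.exp_neg]
      calc _ ≤ (N / (8 * s))⁻¹ := inv_anti₀ hu (by linarith)
        _ = 8 * s / N := by rw [inv_div]
        _ ≤ 8 * 1 / D ^ 2 := by gcongr
        _ = _ := by ring
    have h2 : (4 * Real.pi * s) ^ (-(3 : ℝ) / 2) ≤
        3 * (4 * Real.pi * (2 * s)) ^ (-(3 : ℝ) / 2) := by
      rw [show 4 * Real.pi * (2 * s) = 2 * (4 * Real.pi * s) by ring,
        Real.mul_rpow (by norm_num) h4.le, ← mul_assoc]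
      have : (1 : ℝ) ≤ 3 * 2 ^ (-(3 : ℝ) / 2) := by
        have h3 : (2 : ℝ) ^ (-(3 : ℝ) / 2) * 2 ^ (-(3 : ℝ) / 2) = 1 / 8 := by
          rw [← Real.rpow_add (by norm_num)]
          norm_num
        have : 0 < (2 : ℝ) ^ (-(3 : ℝ) / 2) := by positivity
        nlinarith
      exact le_mul_of_one_le_left (by positivity) this
    simp only [gauss, Nat.cast_ofNat]
    have he : Real.exp (-N / (4 * s)) =
        Real.exp (-N / (8 * s)) * Real.exp (-N / (4 * (2 * s))) := by
      rw [← Real.exp_add]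
      congr 1
      field_simp
      ring
    rw [he]
    calc _ ≤ (3 * (4 * Real.pi * (2 * s)) ^ (-(3 : ℝ) / 2)) *
          ((8 / D ^ 2) * Real.exp (-N / (4 * (2 * s)))) := by gcongr
      _ = _ := by ring
  calc _ ≤ ∫⁻ z in B, ENNReal.ofReal (24 / D ^ 2) * ENNReal.ofReal (gauss 3 (2 * s) x z) :=
        setLIntegral_mono' hB hle
    _ ≤ ∫⁻ z, ENNReal.ofReal (24 / D ^ 2) * ENNReal.ofReal (gauss 3 (2 * s) x z) :=
        setLIntegral_le_lintegral _ _
    _ = _ := by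
        rw [lintegral_const_mul' _ _ ENNReal.ofReal_ne_top, lintegral_gauss (by positivity),
          mul_one]

/-- Time integral of the bound for the occupation of a tube. -/
theorem lintegral_min_one_div_le {a : ℝ} (ha : 0 < a) (ha1 : a ≤ 1) :
    ∫⁻ s in Set.Ioo (0 : ℝ) 1, min 1 (ENNReal.ofReal (a / s)) ≤
      ENNReal.ofReal (a * (1 + Real.log (1 / a))) := by
  have hsub : Set.Ioo (0 : ℝ) 1 ⊆ Set.Ioc 0 a ∪ Set.Ioc a 1 := by
    rw [Set.Ioc_union_Ioc_eq_Ioc ha.le ha1]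
    exact Set.Ioo_subset_Ioc_self
  have hint : IntervalIntegrable (fun s : ℝ => a * s⁻¹) volume a 1 := by
    apply IntervalIntegrable.const_mul
    refine intervalIntegrable_inv_iff.mpr (Or.inr ?_)
    rw [Set.uIcc_of_le ha1]
    exact fun h => absurd h.1 (not_le.mpr ha)
  have h2 : ∫⁻ s in Set.Ioc a 1, ENNReal.ofReal (a / s) =
      ENNReal.ofReal (a * Real.log (1 / a)) := by
    rw [← integral_inv_of_pos ha one_pos, ← intervalIntegral.integral_const_mul,
      intervalIntegral.integral_of_le ha1, ofReal_integral_eq_lintegral_ofReal]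
    · simp_rw [div_eq_mul_inv]
    · exact (intervalIntegrable_iff_integrableOn_Ioc_of_le ha1).mp hint
    · refine (ae_restrict_iff' measurableSet_Ioc).mpr (ae_of_all _ fun s hs => ?_)
      have : 0 < s := ha.trans hs.1
      simp only [Pi.zero_apply]
      positivity
  have hlog : 0 ≤ Real.log (1 / a) := Real.log_nonneg (by rw [le_div_iff₀ ha]; linarith)
  calc _ ≤ ∫⁻ s in Set.Ioc 0 a ∪ Set.Ioc a 1, min 1 (ENNReal.ofReal (a / s)) :=
        lintegral_mono_set hsub
    _ ≤ (∫⁻ s in Set.Ioc 0 a, min 1 (ENNReal.ofReal (a / s))) +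
        ∫⁻ s in Set.Ioc a 1, min 1 (ENNReal.ofReal (a / s)) := lintegral_union_le _ _ _
    _ ≤ (∫⁻ s in Set.Ioc 0 a, 1) + ∫⁻ s in Set.Ioc a 1, ENNReal.ofReal (a / s) := by
        gcongr
        · exact min_le_left _ _
        · exact min_le_right _ _
    _ = ENNReal.ofReal a + ENNReal.ofReal (a * Real.log (1 / a)) := by
        rw [h2]
        simp
    _ = _ := by
        rw [← ENNReal.ofReal_add ha.le (by positivity)]
        ring_nf

/-- The Gaussian bridge is a Gaussian. -/
theorem gauss_bridge {s t : ℝ} (hs : 0 < s) (hst : s < t) (x y z : EuclideanSpace ℝ (Fin 3)) :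
    gauss 3 s x z * gauss 3 (t - s) z y / gauss 3 t x y =
      gauss 3 (s * (t - s) / t) (x + (s / t) • (y - x)) z := by
  have ht : 0 < t := hs.trans hst
  have hts : 0 < t - s := sub_pos.mpr hst
  have hp := Real.pi_pos
  simp only [gauss]
  rw [mul_mul_mul_comm, mul_div_mul_comm, ← Real.mul_rpow (by positivity) (by positivity),
    ← Real.div_rpow (by positivity) (by positivity), ← Real.exp_add, ← Real.exp_sub]
  congr 2
  · field_simp
  · simp only [EuclideanSpace.real_norm_sq_eq, Fin.sum_univ_three, PiLp.sub_apply, PiLp.add_apply,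
      PiLp.smul_apply, smul_eq_mul]
    field_simp
    ring

theorem measurable_gauss {α : Type*} [MeasurableSpace α] {d : ℕ} {s : α → ℝ}
    {m z : α → EuclideanSpace ℝ (Fin d)} (hs : Measurable s) (hm : Measurable m)
    (hz : Measurable z) : Measurable fun a => gauss d (s a) (m a) (z a) := by
  unfold gauss
  fun_prop

/-- Lower bound for the Gaussian mass of a ball of radius comparable to its deviation. -/
noncomputable def ballMass : ℝ≥0∞ :=
  ENNReal.ofReal ((4 * Real.pi) ^ (-(3 : ℝ) / 2) * Real.exp (-1 / 4)) *
    volume (Metric.ball (0 : EuclideanSpace ℝ (Fin 3)) 1)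

theorem ballMass_ne_zero : ballMass ≠ 0 := by
  have h := Real.pi_pos
  refine mul_ne_zero ?_ (Metric.measure_ball_pos _ _ one_pos).ne'
  rw [Ne, ENNReal.ofReal_eq_zero, not_le]
  positivity

theorem ballMass_le_setLIntegral_gauss {σ : ℝ} (hσ : 0 < σ) (m : EuclideanSpace ℝ (Fin 3))
    {B : Set (EuclideanSpace ℝ (Fin 3))} (hB : Metric.ball m √σ ⊆ B) :
    ballMass ≤ ∫⁻ z in B, ENNReal.ofReal (gauss 3 σ m z) := by
  have hp := Real.pi_pos
  have hle : ∀ z ∈ Metric.ball m √σ,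
      ENNReal.ofReal ((4 * Real.pi * σ) ^ (-(3 : ℝ) / 2) * Real.exp (-1 / 4)) ≤
        ENNReal.ofReal (gauss 3 σ m z) := by
    intro z hz
    rw [mem_ball_iff_norm] at hz
    apply ENNReal.ofReal_le_ofReal
    simp only [gauss, Nat.cast_ofNat]
    have : ‖z - m‖ ^ 2 ≤ σ := by
      rw [← Real.sq_sqrt hσ.le]
      gcongr
    refine mul_le_mul_of_nonneg_left (Real.exp_le_exp.mpr ?_) (by positivity)
    rw [div_le_div_iff₀ (by norm_num) (by positivity)]
    linarith
  calc ballMass = ∫⁻ _ in Metric.ball m √σ,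
        ENNReal.ofReal ((4 * Real.pi * σ) ^ (-(3 : ℝ) / 2) * Real.exp (-1 / 4)) := by
        rw [setLIntegral_const, Measure.addHaar_ball _ _ (Real.sqrt_nonneg _), ← mul_assoc,
          ← ENNReal.ofReal_mul (by positivity), ballMass]
        congr 2
        rw [Real.mul_rpow (by positivity) hσ.le]
        have : σ ^ (-(3 : ℝ) / 2) * √σ ^ 3 = 1 := by
          rw [Real.sqrt_eq_rpow, ← Real.rpow_natCast, ← Real.rpow_mul hσ.le,
            ← Real.rpow_add hσ]
          norm_num
        simp only [finrank_euclideanSpace, Fintype.card_fin]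
        linear_combination (-(4 * Real.pi) ^ (-(3 : ℝ) / 2) * Real.exp (-1 / 4)) * this
    _ ≤ ∫⁻ z in Metric.ball m √σ, ENNReal.ofReal (gauss 3 σ m z) :=
        setLIntegral_mono' measurableSet_ball hle
    _ ≤ _ := lintegral_mono_set hB

/-- The cell of scale `u` in a block travelled at speed `v`: its positions are those visited
during the times between `4⁻ᵘ / 2` and `4⁻ᵘ`, and its half-width is `2⁻ᵘ`. -/
def cell (v : ℝ) (u : ℕ) : Set (EuclideanSpace ℝ (Fin 3)) :=
  {z | v * (1 / 4) ^ u / 2 - 1 ≤ z 0 ∧ z 0 ≤ v * (1 / 4) ^ u + 1} ∩ tube ((1 / 2) ^ u)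

/-- The potential with height `4ᵘ / u` on the cells of scales `u ∈ S`. -/
noncomputable def block (v : ℝ) (S : Finset ℕ) (z : EuclideanSpace ℝ (Fin 3)) : ℝ≥0∞ :=
  ∑ u ∈ S, (cell v u).indicator (fun _ => ENNReal.ofReal (4 ^ u / u)) z

theorem measurableSet_cell (v : ℝ) (u : ℕ) : MeasurableSet (cell v u) := by
  have h (i : Fin 3) : Measurable fun z : EuclideanSpace ℝ (Fin 3) => z i := by fun_prop
  exact ((measurableSet_le measurable_const (h 0)).inter
    (measurableSet_le (h 0) measurable_const)).inter (measurableSet_tube _)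

theorem measurable_block (v : ℝ) (S : Finset ℕ) : Measurable (block v S) := by
  unfold block
  exact Finset.measurable_sum _ fun u _ => measurable_const.indicator (measurableSet_cell v u)

theorem block_le (v : ℝ) (S : Finset ℕ) (z : EuclideanSpace ℝ (Fin 3)) :
    block v S z ≤ ENNReal.ofReal (∑ u ∈ S, 4 ^ u / (u : ℝ)) := by
  rw [ENNReal.ofReal_sum_of_nonneg fun u _ => by positivity]
  exact Finset.sum_le_sum fun u _ => Set.indicator_le_self _ _ z

theorem lintegral_mul_block {G : ℝ → EuclideanSpace ℝ (Fin 3) → ℝ≥0∞}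
    (hG : Measurable (Function.uncurry G)) (A : Set ℝ) (v : ℝ) (S : Finset ℕ) :
    ∫⁻ s in A, ∫⁻ z, G s z * block v S z =
      ∑ u ∈ S, ENNReal.ofReal (4 ^ u / u) * ∫⁻ s in A, ∫⁻ z in cell v u, G s z := by
  have hGs : ∀ s, Measurable (G s) := fun s => hG.comp measurable_prodMk_left
  have inner : ∀ s, ∫⁻ z, G s z * block v S z =
      ∑ u ∈ S, ENNReal.ofReal (4 ^ u / u) * ∫⁻ z in cell v u, G s z := by
    intro s
    simp_rw [block, Finset.mul_sum]
    have hm : ∀ u ∈ S, Measurable fun z =>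
        G s z * (cell v u).indicator (fun _ => ENNReal.ofReal (4 ^ u / u)) z := fun u _ =>
      (hGs s).mul (measurable_const.indicator (measurableSet_cell v u))
    rw [lintegral_finsetSum _ hm]
    refine Finset.sum_congr rfl fun u _ => ?_
    rw [← lintegral_const_mul' _ _ ENNReal.ofReal_ne_top,
      ← lintegral_indicator (measurableSet_cell v u)]
    congr 1
    funext z
    by_cases hz : z ∈ cell v u <;> simp [hz, mul_comm]
  simp_rw [inner]
  have hm : ∀ u ∈ S, Measurable fun s =>
      ENNReal.ofReal (4 ^ u / u) * ∫⁻ z in cell v u, G s z := fun u _ =>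
    hG.lintegral_prod_right'.const_mul _
  rw [lintegral_finsetSum _ hm]
  exact Finset.sum_congr rfl fun u _ => lintegral_const_mul' _ _ ENNReal.ofReal_ne_top

/-- The heat potential of `F` up to time `t`. -/
noncomputable def heatPot (F : EuclideanSpace ℝ (Fin 3) → ℝ≥0∞) (t : ℝ)
    (x : EuclideanSpace ℝ (Fin 3)) : ℝ≥0∞ :=
  ∫⁻ s in Set.Ioo (0 : ℝ) t, ∫⁻ z, ENNReal.ofReal (gauss 3 s x z) * F z

theorem cell_potential_le_near {u : ℕ} (hu : 1 ≤ u) (v : ℝ) (x : EuclideanSpace ℝ (Fin 3)) :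
    ENNReal.ofReal (4 ^ u / u) *
      ∫⁻ s in Set.Ioo (0 : ℝ) 1, ∫⁻ z in cell v u, ENNReal.ofReal (gauss 3 s x z) ≤ 4 := by
  have hu' : (1 : ℝ) ≤ u := by exact_mod_cast hu
  have h1 : ∀ s ∈ Set.Ioo (0 : ℝ) 1, ∫⁻ z in cell v u, ENNReal.ofReal (gauss 3 s x z) ≤
      min 1 (ENNReal.ofReal ((1 / 4) ^ u / s)) := by
    intro s hs
    refine le_min ?_ ?_
    · rw [← lintegral_gauss hs.1 x]
      exact setLIntegral_le_lintegral _ _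
    · have := setLIntegral_gauss_tube_le hs.1 (by positivity : (0 : ℝ) ≤ (1 / 2) ^ u) x
      rw [← pow_mul, mul_comm, pow_mul] at this
      norm_num at this ⊢
      exact (lintegral_mono_set Set.inter_subset_right).trans (by simpa using this)
  calc _ ≤ ENNReal.ofReal (4 ^ u / u) *
        ∫⁻ s in Set.Ioo (0 : ℝ) 1, min 1 (ENNReal.ofReal ((1 / 4) ^ u / s)) := by
        exact mul_le_mul_right (setLIntegral_mono' measurableSet_Ioo h1) _
    _ ≤ ENNReal.ofReal (4 ^ u / u) *
        ENNReal.ofReal ((1 / 4) ^ u * (1 + Real.log (1 / (1 / 4) ^ u))) := by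
        gcongr
        exact lintegral_min_one_div_le (by positivity) (pow_le_one₀ (by norm_num) (by norm_num))
    _ = ENNReal.ofReal (1 / u + Real.log 4) := by
        rw [← ENNReal.ofReal_mul (by positivity)]
        congr 1
        rw [one_div_pow, one_div_one_div, Real.log_pow]
        field_simp
    _ ≤ ENNReal.ofReal 4 := by
        apply ENNReal.ofReal_le_ofReal
        have : (1 : ℝ) / u ≤ 1 := by rw [div_le_one (by linarith)]; exact hu'
        linarith [Real.log_le_sub_one_of_pos (show (0 : ℝ) < 4 by norm_num)]
    _ = 4 := by norm_num

theorem cell_potential_le_far {u : ℕ} {v D : ℝ} (hD : 0 < D) (x : EuclideanSpace ℝ (Fin 3))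
    (h : ∀ z ∈ cell v u, D ≤ |z 0 - x 0|) :
    ENNReal.ofReal (4 ^ u / u) *
      ∫⁻ s in Set.Ioo (0 : ℝ) 1, ∫⁻ z in cell v u, ENNReal.ofReal (gauss 3 s x z) ≤
        ENNReal.ofReal (4 ^ u / u * (24 / D ^ 2)) := by
  rw [ENNReal.ofReal_mul (by positivity)]
  gcongr
  calc _ ≤ ∫⁻ s in Set.Ioo (0 : ℝ) 1, ENNReal.ofReal (24 / D ^ 2) :=
        setLIntegral_mono' measurableSet_Ioo fun s hs =>
          setLIntegral_gauss_far_le hs.1 hs.2.le hD x (measurableSet_cell v u) h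
    _ = _ := by simp

theorem measurable_heatKernel (x : EuclideanSpace ℝ (Fin 3)) : Measurable
    (Function.uncurry fun (s : ℝ) (z : EuclideanSpace ℝ (Fin 3)) =>
      ENNReal.ofReal (gauss 3 s x z)) :=
  (measurable_gauss measurable_fst measurable_const measurable_snd).ennreal_ofReal

/-- If the cells are far apart, a block has a heat potential bounded independently of the
scales involved. -/
theorem heatPot_block_le {v D : ℝ} {S : Finset ℕ} (hS : ∀ u ∈ S, 1 ≤ u) (hD : 1 ≤ D)
    (hDS : 24 * ∑ u ∈ S, 4 ^ u / (u : ℝ) ≤ D)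
    (hv : ∀ u ∈ S, 8 * D + 8 ≤ v * (1 / 4) ^ u) (x : EuclideanSpace ℝ (Fin 3)) :
    heatPot (block v S) 1 x ≤ 5 := by
  rw [heatPot, lintegral_mul_block (measurable_heatKernel x)]
  set a : ℕ → ℝ≥0∞ := fun u => ENNReal.ofReal (4 ^ u / u) *
    ∫⁻ s in Set.Ioo (0 : ℝ) 1, ∫⁻ z in cell v u, ENNReal.ofReal (gauss 3 s x z) with ha
  have hD0 : 0 < D := by linarith
  let near : ℕ → Prop := fun u => ∃ z ∈ cell v u, |z 0 - x 0| < D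
  have sep : ∀ u ∈ S, ∀ w ∈ S, u < w → near u → near w → False := by
    rintro u hu w hw huw ⟨z, hz, hzx⟩ ⟨z', hz', hzx'⟩
    have h1 := hz.1.1
    have h2 := hz'.1.2
    have hvu := hv u hu
    have hv0 : 0 ≤ v := by
      by_contra! hneg
      have : v * (1 / 4) ^ u < 0 := mul_neg_of_neg_of_pos hneg (by positivity)
      linarith
    have h3 : v * (1 / 4) ^ w ≤ v * (1 / 4) ^ u / 4 := by
      calc _ ≤ v * (1 / 4) ^ (u + 1) := mul_le_mul_of_nonneg_left
            (pow_le_pow_of_le_one (by norm_num) (by norm_num) huw) hv0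
        _ = _ := by ring
    rw [abs_lt] at hzx hzx'
    linarith [hzx.1, hzx.2, hzx'.1, hzx'.2]
  have uniq : ∀ u ∈ S, ∀ w ∈ S, near u → near w → u = w := by
    intro u hu w hw nu nw
    rcases lt_trichotomy u w with h | h | h
    · exact (sep u hu w hw h nu nw).elim
    · exact h
    · exact (sep w hw u hu h nw nu).elim
  have far : ∀ u ∈ S, ¬ near u → a u ≤ ENNReal.ofReal (4 ^ u / u * (24 / D ^ 2)) := by
    intro u _ hn
    refine cell_potential_le_far hD0 x fun z hz => ?_
    by_contra! hlt
    exact hn ⟨z, hz, hlt⟩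
  obtain ⟨w, hw⟩ : ∃ w, ∀ u ∈ S, u ≠ w → ¬ near u := by
    by_cases h : ∃ w ∈ S, near w
    · obtain ⟨w, hwS, hw⟩ := h
      exact ⟨w, fun u hu hne hn => hne (uniq u hu w hwS hn hw)⟩
    · exact ⟨0, fun u hu _ hn => h ⟨u, hu, hn⟩⟩
  calc ∑ u ∈ S, a u
      ≤ ∑ u ∈ S, ((if u = w then 4 else 0) + ENNReal.ofReal (4 ^ u / u * (24 / D ^ 2))) := by
        refine Finset.sum_le_sum fun u hu => ?_
        by_cases h : u = w
        · simpa [h] using le_add_right (cell_potential_le_near (h ▸ hS u hu) v x)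
        · simpa [h] using far u hu (hw u hu h)
    _ = (if w ∈ S then 4 else 0) + ENNReal.ofReal (∑ u ∈ S, 4 ^ u / u * (24 / D ^ 2)) := by
        rw [Finset.sum_add_distrib, Finset.sum_ite_eq',
          ENNReal.ofReal_sum_of_nonneg fun u _ => by positivity]
    _ ≤ 4 + 1 := by
        gcongr
        · split_ifs <;> simp
        · rw [← Finset.sum_mul, ENNReal.ofReal_le_one, mul_div_assoc', div_le_one (by positivity)]
          nlinarith
    _ = 5 := by norm_num

theorem exists_scales (n : ℕ) :
    ∃ S : Finset ℕ, (∀ u ∈ S, n + 1 ≤ u) ∧ (4 : ℝ) ^ n ≤ ∑ u ∈ S, 1 / (u : ℝ) := by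
  have h := (Real.tendsto_sum_range_one_div_nat_succ_atTop.eventually_ge_atTop
    ((4 : ℝ) ^ n + ∑ i ∈ Finset.range n, 1 / ((i : ℝ) + 1))).and (eventually_ge_atTop n)
  obtain ⟨K, hK, hnK⟩ := h.exists
  refine ⟨(Finset.Ico n K).image (· + 1), ?_, ?_⟩
  · simp only [Finset.mem_image, Finset.mem_Ico]
    rintro u ⟨i, hi, rfl⟩
    omega
  · rw [Finset.sum_image (fun _ _ _ _ h => by simpa using h), Finset.sum_Ico_eq_sub _ hnK]
    push_cast
    linarith

theorem exists_block (n : ℕ) : ∃ (v : ℝ) (S : Finset ℕ), 0 < v ∧ (∀ u ∈ S, n + 1 ≤ u) ∧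
    (4 : ℝ) ^ n ≤ ∑ u ∈ S, 1 / (u : ℝ) ∧ (∀ x, heatPot (block v S) 1 x ≤ 5) ∧
    ∀ z, block v S z ≠ 0 → (n : ℝ) ≤ z 0 := by
  obtain ⟨S, hS, hsum⟩ := exists_scales n
  set D : ℝ := 24 * ∑ u ∈ S, 4 ^ u / (u : ℝ) + 1
  have hD : 1 ≤ D := by
    have : 0 ≤ ∑ u ∈ S, 4 ^ u / (u : ℝ) := Finset.sum_nonneg fun u _ => by positivity
    simp only [D]
    linarith
  set v : ℝ := 4 ^ (S.sup id) * (8 * D + 8 + 2 * n)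
  have hv : ∀ u ∈ S, 8 * D + 8 + 2 * n ≤ v * (1 / 4) ^ u := by
    intro u hu
    have hle : u ≤ S.sup id := Finset.le_sup (f := id) hu
    have : (1 : ℝ) ≤ 4 ^ (S.sup id) * (1 / 4) ^ u := by
      rw [one_div_pow, mul_one_div, one_le_div (by positivity)]
      exact pow_le_pow_right₀ (by norm_num) hle
    calc _ ≤ (4 ^ (S.sup id) * (1 / 4) ^ u) * (8 * D + 8 + 2 * n) :=
          le_mul_of_one_le_left (by positivity) this
      _ = _ := by ring
  have hn : (0 : ℝ) ≤ n := Nat.cast_nonneg n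
  refine ⟨v, S, by positivity, hS, hsum, fun x => heatPot_block_le
    (fun u hu => by have := hS u hu; omega) hD (by simp [D]) (fun u hu => by linarith [hv u hu]) x,
    fun z hz => ?_⟩
  obtain ⟨u, hu, hne⟩ := Finset.exists_ne_zero_of_sum_ne_zero hz
  have hz := (Set.mem_of_indicator_ne_zero hne).1.1
  linarith [hv u hu]

/-- The bridge in time `t` from the origin to `v t e₀` is in the cell of scale `u` with
probability at least `ballMass` during the corresponding times. -/
theorem ballMass_le_bridge_cell {v s t : ℝ} {u : ℕ} (hst : s < t)
    (hs : s ∈ Set.Ioc ((1 / 4 : ℝ) ^ u / 2) ((1 / 4) ^ u)) (hv : 0 < v) :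
    ballMass ≤ ∫⁻ z in cell v u, ENNReal.ofReal (gauss 3 s 0 z *
      gauss 3 (t - s) z (EuclideanSpace.single 0 (v * t)) /
        gauss 3 t 0 (EuclideanSpace.single 0 (v * t))) := by
  have hs0 : 0 < s := lt_trans (by positivity) hs.1
  have ht : 0 < t := hs0.trans hst
  have hts : 0 < t - s := sub_pos.mpr hst
  simp_rw [gauss_bridge hs0 hst]
  refine ballMass_le_setLIntegral_gauss (by positivity) _ fun z hz => ?_
  have hσ : √(s * (t - s) / t) ≤ (1 / 2) ^ u := by
    rw [Real.sqrt_le_left (by positivity), ← pow_mul, mul_comm u, pow_mul]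
    norm_num
    refine le_trans ?_ (by simpa using hs.2)
    rw [div_le_iff₀ ht]
    nlinarith
  have h1 : ((1 : ℝ) / 2) ^ u ≤ 1 := pow_le_one₀ (by norm_num) (by norm_num)
  rw [mem_ball_iff_norm] at hz
  have hc : ∀ i, |z i - (0 + (s / t) • (EuclideanSpace.single 0 (v * t) - 0) :
      EuclideanSpace ℝ (Fin 3)) i| ≤ (1 / 2) ^ u := fun i =>
    ((PiLp.norm_apply_le (z - _) i).trans hz.le).trans hσ
  have c0 := (hc 0).trans h1
  have c1 := hc 1
  have c2 := hc 2
  have hst' : s / t * (v * t) = v * s := by field_simp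
  simp [hst', -one_div] at c0 c1 c2
  rw [abs_le] at c0
  have m1 : v * ((1 / 4 : ℝ) ^ u / 2) ≤ v * s := mul_le_mul_of_nonneg_left hs.1.le hv.le
  have m2 : v * s ≤ v * (1 / 4 : ℝ) ^ u := mul_le_mul_of_nonneg_left hs.2 hv.le
  refine ⟨⟨?_, ?_⟩, c1, c2⟩ <;> linarith [c0.1, c0.2]

theorem katoA_eq_iSup_heatPot {V : EuclideanSpace ℝ (Fin 3) → ℝ}
    {F : EuclideanSpace ℝ (Fin 3) → ℝ≥0∞} (h : ∀ z, ENNReal.ofReal |V z| = F z) (t : ℝ) :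
    katoA 3 V t = ⨆ x, heatPot F t x := by
  refine iSup_congr fun x => setLIntegral_congr_fun measurableSet_Ioo fun s hs => ?_
  refine lintegral_congr fun z => ?_
  rw [ENNReal.ofReal_mul (gauss_nonneg hs.1.le _ _), h]

theorem heatPot_tsum {W : ℕ → EuclideanSpace ℝ (Fin 3) → ℝ≥0∞} (hW : ∀ n, Measurable (W n))
    (t : ℝ) (x : EuclideanSpace ℝ (Fin 3)) :
    heatPot (fun z => ∑' n, W n z) t x = ∑' n, heatPot (W n) t x := by
  have hk := measurable_heatKernel x
  have hm : ∀ n, Measurable (Function.uncurry fun (s : ℝ) (z : EuclideanSpace ℝ (Fin 3)) =>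
      ENNReal.ofReal (gauss 3 s x z) * W n z) := fun n => hk.mul ((hW n).comp measurable_snd)
  simp_rw [heatPot, ← ENNReal.tsum_mul_left]
  have inner : ∀ s, ∫⁻ z, ∑' n, ENNReal.ofReal (gauss 3 s x z) * W n z =
      ∑' n, ∫⁻ z, ENNReal.ofReal (gauss 3 s x z) * W n z := fun s =>
    lintegral_tsum fun n => ((hm n).comp measurable_prodMk_left).aemeasurable
  simp_rw [inner]
  exact lintegral_tsum fun n => (hm n).lintegral_prod_right'.aemeasurable

theorem heatPot_const_mul {c : ℝ≥0∞} (hc : c ≠ ⊤) (F : EuclideanSpace ℝ (Fin 3) → ℝ≥0∞)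
    (t : ℝ) (x : EuclideanSpace ℝ (Fin 3)) :
    heatPot (fun z => c * F z) t x = c * heatPot F t x := by
  simp_rw [heatPot, mul_left_comm _ c, lintegral_const_mul' _ _ hc]

theorem heatPot_mono_time (F : EuclideanSpace ℝ (Fin 3) → ℝ≥0∞) {t t' : ℝ} (h : t ≤ t')
    (x : EuclideanSpace ℝ (Fin 3)) : heatPot F t x ≤ heatPot F t' x :=
  lintegral_mono_set (Set.Ioo_subset_Ioo_right h)

theorem heatPot_le_of_bounded {F : EuclideanSpace ℝ (Fin 3) → ℝ≥0∞} {M : ℝ≥0∞} (hM : M ≠ ⊤)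
    (h : ∀ z, F z ≤ M) (t : ℝ) (x : EuclideanSpace ℝ (Fin 3)) :
    heatPot F t x ≤ M * ENNReal.ofReal t := by
  calc _ ≤ ∫⁻ s in Set.Ioo (0 : ℝ) t, M := by
        refine setLIntegral_mono' measurableSet_Ioo fun s hs => ?_
        calc _ ≤ ∫⁻ z, ENNReal.ofReal (gauss 3 s x z) * M :=
              lintegral_mono fun z => mul_le_mul_right (h z) _
          _ = M := by rw [lintegral_mul_const' _ _ hM, lintegral_gauss hs.1, one_mul]
    _ = _ := by simp

theorem tendsto_tsum_min_mul {M : ℕ → ℝ} (hM : ∀ n, 0 ≤ M n) :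
    Tendsto (fun t : ℝ => ∑' n, ENNReal.ofReal (min (5 * (1 / 2) ^ n) (M n * t)))
      (nhdsWithin 0 (Set.Ioi 0)) (nhds 0) := by
  have hsum : Summable fun n : ℕ => 5 * (1 / 2 : ℝ) ^ n := summable_geometric_two.mul_left 5
  have hnn : ∀ t : ℝ, 0 < t → ∀ n, 0 ≤ min (5 * (1 / 2 : ℝ) ^ n) (M n * t) := fun t ht n =>
    le_min (by positivity) (mul_nonneg (hM n) ht.le)
  have key : Tendsto (fun t : ℝ => ∑' n, min (5 * (1 / 2 : ℝ) ^ n) (M n * t))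
      (nhdsWithin 0 (Set.Ioi 0)) (nhds (∑' _ : ℕ, 0)) := by
    refine tendsto_tsum_of_dominated_convergence hsum (fun n => ?_) ?_
    · have : Tendsto (fun t : ℝ => min (5 * (1 / 2 : ℝ) ^ n) (M n * t)) (nhds 0)
          (nhds (min (5 * (1 / 2 : ℝ) ^ n) (M n * 0))) :=
        Continuous.tendsto (by fun_prop) 0
      rw [mul_zero, min_eq_right (by positivity)] at this
      exact this.mono_left nhdsWithin_le_nhds
    · filter_upwards [self_mem_nhdsWithin] with t ht n
      rw [Real.norm_eq_abs, abs_of_nonneg (hnn t ht n)]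
      exact min_le_left _ _
  rw [tsum_zero] at key
  have := ENNReal.tendsto_ofReal key
  rw [ENNReal.ofReal_zero] at this
  refine this.congr' ?_
  filter_upwards [self_mem_nhdsWithin] with t ht
  exact ENNReal.ofReal_tsum_of_nonneg (hnn t ht)
    (hsum.of_nonneg_of_le (hnn t ht) fun n => min_le_left _ _)

theorem stmt1 :
    ∃ V : EuclideanSpace ℝ (Fin 3) → ℝ, Measurable V ∧ (∀ z, V z ≤ 0) ∧
      Tendsto (fun t => katoA 3 V t) (nhdsWithin 0 (Set.Ioi 0)) (nhds 0) ∧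
      (∀ t : ℝ, 0 < t → SNorm 3 V t = ⊤) := by
  choose v S hv hS hsum hpot hsupp using exists_block
  let W : ℕ → EuclideanSpace ℝ (Fin 3) → ℝ≥0∞ := fun n z =>
    ENNReal.ofReal ((1 / 2) ^ n) * block (v n) (S n) z
  let F : EuclideanSpace ℝ (Fin 3) → ℝ≥0∞ := fun z => ∑' n, W n z
  have hW : ∀ n, Measurable (W n) := fun n => (measurable_block _ _).const_mul _
  have hF : Measurable F := Measurable.tsum hW
  have hfin : ∀ z, F z ≠ ⊤ := by
    intro z
    have hz : ∀ n ∉ Finset.range (⌊z 0⌋₊ + 1), W n z = 0 := by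
      intro n hn
      by_contra h
      have := Nat.le_floor (hsupp n z (right_ne_zero_of_mul h))
      simp only [Finset.mem_range] at hn
      omega
    simp only [F]
    rw [tsum_eq_sum hz]
    exact ENNReal.sum_ne_top.mpr fun n _ => ENNReal.mul_ne_top ENNReal.ofReal_ne_top
      (ne_top_of_le_ne_top ENNReal.ofReal_ne_top (block_le _ _ _))
  have habs : ∀ z, ENNReal.ofReal |-(F z).toReal| = F z := fun z => by
    rw [abs_neg, abs_of_nonneg ENNReal.toReal_nonneg, ENNReal.ofReal_toReal (hfin z)]
  refine ⟨fun z => -(F z).toReal, hF.ennreal_toReal.neg,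
    fun z => neg_nonpos.mpr ENNReal.toReal_nonneg, ?_, fun t ht => ?_⟩
  · let M : ℕ → ℝ := fun n => (1 / 2) ^ n * ∑ u ∈ S n, 4 ^ u / (u : ℝ)
    have hM : ∀ n, 0 ≤ M n := fun n =>
      mul_nonneg (by positivity) (Finset.sum_nonneg fun u _ => by positivity)
    refine tendsto_of_tendsto_of_tendsto_of_le_of_le' tendsto_const_nhds
      (tendsto_tsum_min_mul hM) (Eventually.of_forall fun _ => zero_le) ?_
    filter_upwards [Ioo_mem_nhdsGT one_pos] with t ht
    rw [katoA_eq_iSup_heatPot habs]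
    refine iSup_le fun x => ?_
    simp only [F]
    rw [heatPot_tsum hW]
    refine ENNReal.tsum_le_tsum fun n => ?_
    rw [ENNReal.ofReal_min]
    refine le_min ?_ ?_
    · rw [mul_comm, ENNReal.ofReal_mul (by positivity)]
      simp only [W]
      rw [heatPot_const_mul ENNReal.ofReal_ne_top]
      refine mul_le_mul_right (((heatPot_mono_time _ ht.2.le x).trans (hpot n x)).trans ?_) _
      simp
    · rw [ENNReal.ofReal_mul (hM n)]
      refine heatPot_le_of_bounded ENNReal.ofReal_ne_top (fun z => ?_) t x
      rw [ENNReal.ofReal_mul (by positivity)]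
      exact mul_le_mul_right (block_le _ _ _) _
  · have hbig : Tendsto (fun n : ℕ => ballMass * ENNReal.ofReal (2 ^ n / 2)) atTop (nhds ⊤) := by
      have h1 : Tendsto (fun n : ℕ => (2 : ℝ) ^ n / 2) atTop atTop :=
        (tendsto_pow_atTop_atTop_of_one_lt one_lt_two).atTop_div_const two_pos
      have h2 := ENNReal.Tendsto.const_mul (a := ballMass)
        (ENNReal.tendsto_ofReal_atTop.comp h1) (Or.inl ENNReal.top_ne_zero)
      rwa [ENNReal.mul_top ballMass_ne_zero] at h2
    refine top_le_iff.mp (le_of_tendsto hbig ?_)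
    have hsmall : ∀ᶠ n : ℕ in atTop, (1 / 4 : ℝ) ^ n < t :=
      (tendsto_pow_atTop_nhds_zero_of_lt_one (by norm_num) (by norm_num)).eventually_lt_const ht
    filter_upwards [hsmall] with n hn
    have hn' : ∀ u ∈ S n, (1 / 4 : ℝ) ^ u < t := fun u hu =>
      (pow_le_pow_of_le_one (by norm_num) (by norm_num)
        (by have := hS n u hu; omega)).trans_lt hn
    set y : EuclideanSpace ℝ (Fin 3) := EuclideanSpace.single 0 (v n * t)
    let G : ℝ → EuclideanSpace ℝ (Fin 3) → ℝ≥0∞ := fun s z =>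
      ENNReal.ofReal (gauss 3 s 0 z * gauss 3 (t - s) z y / gauss 3 t 0 y)
    have hG : Measurable (Function.uncurry G) :=
      (((measurable_gauss measurable_fst measurable_const measurable_snd).mul
        (measurable_gauss (measurable_const.sub measurable_fst) measurable_snd
          measurable_const)).div_const _).ennreal_ofReal
    have hcell : ∀ u ∈ S n, ballMass * ENNReal.ofReal ((1 / 4) ^ u / 2) ≤
        ∫⁻ s in Set.Ioo (0 : ℝ) t, ∫⁻ z in cell (v n) u, G s z := by
      intro u hu
      have hsub : Set.Ioc ((1 / 4 : ℝ) ^ u / 2) ((1 / 4) ^ u) ⊆ Set.Ioo 0 t := fun s hs =>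
        ⟨lt_trans (by positivity) hs.1, hs.2.trans_lt (hn' u hu)⟩
      calc _ = ∫⁻ s in Set.Ioc ((1 / 4 : ℝ) ^ u / 2) ((1 / 4) ^ u), ballMass := by
            rw [setLIntegral_const, Real.volume_Ioc, sub_half]
        _ ≤ ∫⁻ s in Set.Ioc ((1 / 4 : ℝ) ^ u / 2) ((1 / 4) ^ u), ∫⁻ z in cell (v n) u, G s z :=
            setLIntegral_mono' measurableSet_Ioc fun s hs =>
              ballMass_le_bridge_cell (hsub hs).2 hs (hv n)
        _ ≤ _ := lintegral_mono_set hsub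
    calc ballMass * ENNReal.ofReal (2 ^ n / 2)
        ≤ ENNReal.ofReal ((1 / 2) ^ n) * ∑ u ∈ S n, ENNReal.ofReal (4 ^ u / u) *
            (ballMass * ENNReal.ofReal ((1 / 4) ^ u / 2)) := by
          have hterm : ∀ u ∈ S n, ENNReal.ofReal (4 ^ u / u) *
              (ballMass * ENNReal.ofReal ((1 / 4) ^ u / 2)) =
                ballMass * ENNReal.ofReal (1 / (u : ℝ) / 2) := by
            intro u _
            rw [mul_left_comm, ← ENNReal.ofReal_mul (by positivity)]
            congr 2
            rw [one_div_pow]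
            field_simp
          rw [Finset.sum_congr rfl hterm, ← Finset.mul_sum, mul_left_comm,
            ← ENNReal.ofReal_sum_of_nonneg fun u _ => by positivity,
            ← ENNReal.ofReal_mul (by positivity), ← Finset.sum_div]
          refine mul_le_mul_right (ENNReal.ofReal_le_ofReal ?_) _
          calc (2 : ℝ) ^ n / 2 = (1 / 2) ^ n * (4 ^ n / 2) := by
                rw [show (4 : ℝ) = 2 * 2 by norm_num, mul_pow, one_div_pow]
                field_simp
            _ ≤ _ := by
                gcongr
                exact hsum n
      _ ≤ ENNReal.ofReal ((1 / 2) ^ n) *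
            ∫⁻ s in Set.Ioo (0 : ℝ) t, ∫⁻ z, G s z * block (v n) (S n) z := by
          rw [lintegral_mul_block hG]
          gcongr with u hu
          exact hcell u hu
      _ = ∫⁻ s in Set.Ioo (0 : ℝ) t, ∫⁻ z, G s z * W n z := by
          simp_rw [W, mul_left_comm (G _ _), lintegral_const_mul' _ _ ENNReal.ofReal_ne_top]
      _ ≤ ∫⁻ s in Set.Ioo (0 : ℝ) t, ∫⁻ z, G s z * F z := by
          gcongr with s z
          exact ENNReal.le_tsum n
      _ = Sk 3 (fun z => -(F z).toReal) t 0 y := by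
          refine setLIntegral_congr_fun measurableSet_Ioo fun s hs => lintegral_congr fun z => ?_
          rw [ENNReal.ofReal_mul (div_nonneg (mul_nonneg (gauss_nonneg hs.1.le _ _)
            (gauss_nonneg (sub_nonneg.mpr hs.2.le) _ _)) (gauss_nonneg ht.le _ _)), habs]
      _ ≤ _ := le_iSup₂ (f := fun x y => Sk 3 (fun z => -(F z).toReal) t x y) 0 y
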